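/- arXiv:2403.10999 — 9 statements merged into one kernel-verified Lean document; each statement's English description precedes it below -/
import Mathlib

section
/- Let D be a noncommutative division ring with center F, and let a ∈ D be algebraic over F with minimal polynomial λ(x) of degree n > 2. Then there exists a monic quadratic polynomial P(x) ∈ D[x] such that: (1) the set of roots of P(x) lying in the conjugacy class [a] is infinite; (2) the set of elements of [a] that are not roots of P(x) is infinite; and (3) λ(x) does not divide P(x) in D[x] (i.e., there is no Q(x) ∈ D[x] with P(x) = Q(x)·λ(x)). -/
open Polynomial

/-- The conjugacy class of `a` in a division ring. -/
def conjClass {D : Type*} [DivisionRing D] (a : D) : Set D :=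
  {b | ∃ d : D, d ≠ 0 ∧ b = d * a * d⁻¹}

section DivisionRing

variable {D : Type*} [DivisionRing D]

theorem Polynomial.exists_eq_mul_X_sub_C_add_C_eval (p : D[X]) (c : D) :
    ∃ q : D[X], p = q * (X - C c) + C (p.eval c) := by
  induction p using Polynomial.induction_on' with
  | add p q hp hq =>
    obtain ⟨u, hu⟩ := hp
    obtain ⟨v, hv⟩ := hq
    refine ⟨u + v, ?_⟩
    rw [eval_add, C_add, add_mul]
    nth_rewrite 1 [hu, hv]
    abel
  | monomial n b =>
    have h := (commute_X (C c)).geom_sum₂_mul n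
    refine ⟨C b * ∑ i ∈ Finset.range n, X ^ i * C c ^ (n - 1 - i), ?_⟩
    rw [mul_assoc, h, eval_monomial, ← C_mul_X_pow_eq_monomial, C_mul, C_pow, mul_sub]
    abel

theorem Polynomial.eval_mul_X_sub_C_mul_C (q : D[X]) (a c d : D) :
    (q * (X - C c) * C d).eval a = (q * C (d * a - c * d)).eval a := by
  have h : q * (X - C c) * C d = q * C d * (X - C a) + q * C (d * a - c * d) := by
    simp only [mul_assoc, ← mul_add]
    congr 1
    simp only [C_sub, C_mul, mul_sub, sub_mul, X_mul_C]
    abel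
  rw [h, eval_add, eval_mul_X_sub_C, zero_add]

theorem Polynomial.eval_mul_C_eq_eval_conj_mul (p : D[X]) (a : D) {d : D} (hd : d ≠ 0) :
    (p * C d).eval a = p.eval (d * a * d⁻¹) * d := by
  obtain ⟨q, hq⟩ := p.exists_eq_mul_X_sub_C_add_C_eval (d * a * d⁻¹)
  nth_rewrite 1 [hq]
  rw [add_mul, eval_add, eval_mul_X_sub_C_mul_C, ← C_mul, eval_C]
  simp [mul_assoc, hd]

theorem finite_setOf_mul_sub_mul_eq (a c y : D) (hK : {k : D | Commute k a}.Finite) :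
    {d : D | d * a - c * d = y}.Finite := by
  have hker : {d : D | d * a - c * d = 0}.Finite := by
    by_cases h : ∃ e : D, e ≠ 0 ∧ e * a - c * e = 0
    · obtain ⟨e, he, hea⟩ := h
      refine (hK.image (e * ·)).subset fun d hd => ⟨e⁻¹ * d, ?_, by simp [he]⟩
      rw [sub_eq_zero] at hea
      have hda : d * a = c * d := sub_eq_zero.1 hd
      have hc : c = e * a * e⁻¹ := by rw [hea, mul_assoc, mul_inv_cancel₀ he, mul_one]
      change e⁻¹ * d * a = a * (e⁻¹ * d)
      rw [mul_assoc, hda, hc]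
      simp [← mul_assoc, he]
    · push Not at h
      refine (Set.finite_singleton (0 : D)).subset fun d hd => ?_
      by_contra h0
      exact h d h0 hd
  by_cases h : ∃ e : D, e * a - c * e = y
  · obtain ⟨e, he⟩ := h
    refine (hker.image (e + ·)).subset fun d hd => ⟨d - e, ?_, by simp⟩
    change d * a - c * d = y at hd
    change (d - e) * a - c * (d - e) = 0
    rw [sub_mul, mul_sub, sub_sub_sub_comm, hd, he, sub_self]
  · push Not at h
    refine Set.finite_empty.subset fun d hd => h d hd

theorem finite_setOf_eval_mul_C_eq_zero (a : D) (hK : {k : D | Commute k a}.Finite) (n : ℕ) :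
    ∀ p : D[X], p ≠ 0 → p.natDegree = n → {d : D | (p * C d).eval a = 0}.Finite := by
  induction n with
  | zero =>
    intro p hp hn
    obtain ⟨b, rfl⟩ := natDegree_eq_zero.1 hn
    have hb : b ≠ 0 := by rintro rfl; simp at hp
    refine (Set.finite_singleton (0 : D)).subset fun d hd => ?_
    rw [Set.mem_ofPred_eq, ← C_mul, eval_C] at hd
    exact (mul_eq_zero.1 hd).resolve_left hb
  | succ n ih =>
    intro p hp hn
    by_cases h : ∃ e : D, e ≠ 0 ∧ (p * C e).eval a = 0
    · obtain ⟨e, he, hpe⟩ := h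
      rw [eval_mul_C_eq_eval_conj_mul p a he, mul_eq_zero, or_iff_left he] at hpe
      obtain ⟨q, hq⟩ := p.exists_eq_mul_X_sub_C_add_C_eval (e * a * e⁻¹)
      rw [hpe, C_0, add_zero] at hq
      generalize e * a * e⁻¹ = c at hq
      subst hq
      have hq0 : q ≠ 0 := left_ne_zero_of_mul hp
      rw [natDegree_mul hq0 (X_sub_C_ne_zero c), natDegree_X_sub_C] at hn
      refine ((ih q hq0 (by omega)).preimage' fun y _ =>
        finite_setOf_mul_sub_mul_eq a c y hK).subset fun d hd => ?_
      rwa [Set.mem_ofPred_eq, eval_mul_X_sub_C_mul_C] at hd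
    · push Not at h
      refine (Set.finite_singleton (0 : D)).subset fun d hd => ?_
      by_contra h0
      exact h d h0 hd

theorem infinite_setOf_commute (hnc : ∃ x y : D, x * y ≠ y * x) (a : D)
    (ha : IsIntegral (Subring.center D) a) : {k : D | Commute k a}.Infinite := by
  intro hK
  set p := (minpoly (Subring.center D) a).map (algebraMap (Subring.center D) D) with hp
  have hpa : p.eval a = 0 := by
    rw [hp, eval_map_algebraMap, minpoly.aeval]
  have hp0 : p ≠ 0 := ((minpoly.monic ha).map _).ne_zero
  have hcomm : ∀ d : D, p * C d = C d * p := by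
    intro d
    ext i
    rw [coeff_mul_C, coeff_C_mul, hp, coeff_map]
    exact (Subring.mem_center_iff.1 ((minpoly (Subring.center D) a).coeff i).2 d).symm
  have hfin := finite_setOf_eval_mul_C_eq_zero a hK _ p hp0 rfl
  have huniv : {d : D | (p * C d).eval a = 0} = Set.univ := by
    ext d
    simp [hcomm, hpa]
  rw [huniv] at hfin
  have := Set.finite_univ_iff.1 hfin
  obtain ⟨x, y, hxy⟩ := hnc
  exact hxy ((littleWedderburn D).mul_comm x y)

theorem infinite_setOf_conj_add_mul (a w : D) {v : D} (hv : v ≠ 0)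
    (hK : {k : D | Commute k a}.Infinite)
    (hw : ∀ k, Commute k a → w ≠ v * k) :
    {r : D | ∃ k, Commute k a ∧ r = (w + v * k) * a * (w + v * k)⁻¹}.Infinite := by
  have hne : ∀ k, Commute k a → w + v * k ≠ 0 := fun k hk h =>
    hw (-k) hk.neg_left (by rw [mul_neg]; exact eq_neg_of_add_eq_zero_left h)
  refine (hK.image (f := fun k => (w + v * k) * a * (w + v * k)⁻¹) ?_).mono ?_
  · intro k hk k' hk' h
    have hk : Commute k a := hk
    have hk' : Commute k' a := hk'
    have h0 := hne k hk
    have h0' := hne k' hk'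
    have hl : Commute ((w + v * k)⁻¹ * (w + v * k')) a := by
      change (w + v * k) * a * (w + v * k)⁻¹ = (w + v * k') * a * (w + v * k')⁻¹ at h
      generalize w + v * k = x at *
      generalize w + v * k' = y at *
      change x⁻¹ * y * a = a * (x⁻¹ * y)
      have h1 : x * a * x⁻¹ * y = y * a := by
        rw [h, mul_assoc, inv_mul_cancel₀ h0', mul_one]
      rw [mul_assoc, ← h1]
      simp [← mul_assoc, h0]
    obtain ⟨l, hl_def⟩ : ∃ l, l = (w + v * k)⁻¹ * (w + v * k') := ⟨_, rfl⟩
    rw [← hl_def] at hl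
    have hmul : (w + v * k) * l = w + v * k' := by
      rw [hl_def, mul_inv_cancel_left₀ h0]
    have hlin : w * (1 - l) = v * (k * l - k') := by
      rw [mul_sub, mul_one, mul_sub, ← mul_assoc, sub_eq_sub_iff_add_eq_add, ← hmul, add_mul,
        add_comm]
    have hl1 : l = 1 := by
      by_contra hl1
      have h1 : 1 - l ≠ 0 := sub_ne_zero.2 (Ne.symm hl1)
      refine hw ((k * l - k') * (1 - l)⁻¹)
        (((hk.mul_left hl).sub_left hk').mul_left
          (((Commute.one_left a).sub_left hl).inv_left₀)) ?_
      rw [← mul_assoc, ← hlin, mul_assoc, mul_inv_cancel₀ h1, mul_one]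
    rw [hl1, sub_self, mul_zero, mul_one] at hlin
    exact sub_eq_zero.1 ((mul_eq_zero.1 hlin.symm).resolve_left hv)
  · rintro _ ⟨k, hk, rfl⟩
    exact ⟨k, hk, rfl⟩

theorem exists_not_commute_of_two_lt_natDegree_minpoly (a : D)
    (h : 2 < (minpoly (Subring.center D) a).natDegree) : ∃ e : D, ¬ Commute e a := by
  by_contra! hc
  have hle := natDegree_le_natDegree (minpoly.min (Subring.center D) a
    (monic_X_sub_C (⟨a, Subring.mem_center_iff.2 hc⟩ : Subring.center D)) (by
      rw [map_sub, aeval_X, aeval_C]; exact sub_self a))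
  rw [natDegree_X_sub_C] at hle
  omega

theorem exists_eval_mul_C_ne_zero_of_two_lt_natDegree_minpoly (a : D)
    (h : 2 < (minpoly (Subring.center D) a).natDegree) {P : D[X]} (hP : P.Monic)
    (hP2 : P.natDegree = 2) : ∃ d : D, (P * C d).eval a ≠ 0 := by
  by_contra! hall
  have key : ∀ d : D, P.coeff 0 * d + P.coeff 1 * d * a + d * a ^ 2 = 0 := by
    intro d
    have hlead : P.coeff 2 = 1 := by rw [← hP2]; exact hP
    have hd := hall d
    rw [eval_eq_sum_range' (n := 3)
      ((natDegree_mul_C_le P d).trans_lt (by omega))] at hd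
    simpa [Finset.sum_range_succ, hlead] using hd
  obtain ⟨e, he⟩ := exists_not_commute_of_two_lt_natDegree_minpoly a h
  generalize P.coeff 0 = s at key
  generalize P.coeff 1 = t at key
  have hcomm : ∀ u d : D, (s * u - u * s) * d + (t * u - u * t) * d * a = 0 := by
    intro u d
    have h1 := key (u * d)
    have h2 := congrArg (u * ·) (key d)
    simp only [mul_zero] at h2
    rw [← sub_eq_zero.2 (h1.trans h2.symm)]
    noncomm_ring
  have ht : ∀ u, t * u - u * t = 0 := by
    intro u
    by_contra hu
    have h1 := hcomm u 1
    have h2 := hcomm u e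
    rw [mul_one, mul_one] at h1
    rw [eq_neg_of_add_eq_zero_left h1] at h2
    refine he (mul_left_cancel₀ hu ?_)
    rw [← sub_eq_zero, ← h2]
    noncomm_ring
  have hs : ∀ u, s * u - u * s = 0 := by
    intro u
    simpa [ht u] using hcomm u 1
  let s' : Subring.center D := ⟨s, Subring.mem_center_iff.2 fun u => (sub_eq_zero.1 (hs u)).symm⟩
  let t' : Subring.center D := ⟨t, Subring.mem_center_iff.2 fun u => (sub_eq_zero.1 (ht u)).symm⟩
  have hdeg : (C t' * X + C s' : (Subring.center D)[X]).degree < (2 : ℕ) :=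
    degree_linear_lt_degree_C_mul_X_sq (a := (1 : Subring.center D)) one_ne_zero |>.trans_le
      (degree_C_mul_X_pow_le 2 1)
  have hle := natDegree_le_natDegree (minpoly.min (Subring.center D) a
    (monic_X_pow_add hdeg) (by
      have h1 := key 1
      rw [map_add, map_add, map_mul, map_pow, aeval_X, aeval_C, aeval_C]
      change a ^ 2 + (t * a + s) = 0
      rw [← h1]
      noncomm_ring))
  have h2 : (X ^ 2 + (C t' * X + C s')).natDegree ≤ 2 := by compute_degree
  omega

end DivisionRing

/-- **Theorem (quadratic polynomial with infinitely many roots and non-roots in a class).**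
Let `D` be a noncommutative division ring with center `F`, and `a ∈ D` algebraic over `F`
with minimal polynomial of degree `n > 2`.  Then there is a monic quadratic polynomial
`P(x) ∈ D[x]` having infinitely many roots in `[a]`, infinitely many non-roots in `[a]`,
and not divisible (on the right) by the minimal polynomial of `a`. -/
theorem quadratic_poly_exists {D : Type*} [DivisionRing D]
    (hnc : ∃ x y : D, x * y ≠ y * x)
    (a : D) (ha : IsIntegral (Subring.center D) a)
    (n : ℕ) (hn : 2 < n)
    (hdeg : (minpoly (Subring.center D) a).natDegree = n) :
    ∃ P : Polynomial D, P.Monic ∧ P.natDegree = 2 ∧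
      {r : D | r ∈ conjClass a ∧ P.eval r = 0}.Infinite ∧
      {r : D | r ∈ conjClass a ∧ P.eval r ≠ 0}.Infinite ∧
      ¬ ∃ Q : Polynomial D,
        P = Q * (minpoly (Subring.center D) a).map (algebraMap (Subring.center D) D) := by
  subst hdeg
  have hK := infinite_setOf_commute hnc a ha
  obtain ⟨e, he⟩ := exists_not_commute_of_two_lt_natDegree_minpoly a hn
  have he0 : e ≠ 0 := by
    rintro rfl
    exact he (Commute.zero_left a)
  have hs : e * a - a * e ≠ 0 := sub_ne_zero.2 he
  set s := e * a - a * e with hs_def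
  set P : D[X] := (X - C (s * a * s⁻¹)) * (X - C a) with hP_def
  have hP : P.Monic := (monic_X_sub_C _).mul (monic_X_sub_C _)
  have hP2 : P.natDegree = 2 := by
    rw [hP_def, natDegree_mul (X_sub_C_ne_zero _) (X_sub_C_ne_zero _), natDegree_X_sub_C,
      natDegree_X_sub_C]
  have hPa : P.eval a = 0 := eval_mul_X_sub_C a
  have hPe : (P * C e).eval a = 0 := by
    rw [hP_def, eval_mul_X_sub_C_mul_C, ← hs_def, eval_mul_C_eq_eval_conj_mul _ _ hs,
      eval_sub, eval_X, eval_C, sub_self, zero_mul]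
  obtain ⟨d, hd⟩ := exists_eval_mul_C_ne_zero_of_two_lt_natDegree_minpoly a hn hP hP2
  have hlin : ∀ {w v k : D}, Commute k a →
      (P * C (w + v * k)).eval a = (P * C w).eval a + (P * C v).eval a * k := by
    intro w v k hk
    rw [C_add, C_mul, mul_add, eval_add, ← mul_assoc, eval_mul_C_of_commute hk]
  refine ⟨P, hP, hP2, ?_, ?_, ?_⟩
  · have hw : ∀ k, Commute k a → (1 : D) ≠ e * k := fun k hk h => by
      rw [eq_inv_of_mul_eq_one_left h.symm] at he
      exact he hk.inv_left₀
    refine (infinite_setOf_conj_add_mul a 1 he0 hK hw).mono ?_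
    rintro _ ⟨k, hk, rfl⟩
    have hne : 1 + e * k ≠ 0 := fun h =>
      hw (-k) hk.neg_left (by rw [mul_neg]; exact eq_neg_of_add_eq_zero_left h)
    refine ⟨⟨_, hne, rfl⟩, ?_⟩
    have h := hlin (w := 1) (v := e) hk
    rw [eval_mul_C_eq_eval_conj_mul _ _ hne, C_1, mul_one, hPa, hPe, zero_mul, add_zero,
      mul_eq_zero, or_iff_left hne] at h
    exact h
  · have hw : ∀ k, Commute k a → d ≠ 1 * k := fun k hk h => hd <| by
      rw [h, one_mul, eval_mul_C_of_commute hk, hPa, zero_mul]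
    refine (infinite_setOf_conj_add_mul a d one_ne_zero hK hw).mono ?_
    rintro _ ⟨k, hk, rfl⟩
    have h := hlin (w := d) (v := 1) hk
    rw [C_1, mul_one, hPa, zero_mul, add_zero] at h
    rw [← h] at hd
    have hne : d + 1 * k ≠ 0 := by
      intro h0
      rw [h0, C_0, mul_zero, eval_zero] at hd
      exact hd rfl
    rw [eval_mul_C_eq_eval_conj_mul _ _ hne] at hd
    exact ⟨⟨_, hne, rfl⟩, left_ne_zero_of_mul hd⟩
  · rintro ⟨Q, hQ⟩
    have hm := (minpoly.monic ha).map (algebraMap (Subring.center D) D)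
    have hQ0 : Q ≠ 0 := by
      rintro rfl
      exact hP.ne_zero (by rw [hQ, zero_mul])
    rw [hQ, natDegree_mul hQ0 hm.ne_zero, (minpoly.monic ha).natDegree_map] at hP2
    omega
end

section
/- Let ℍ be the real quaternions and let P(x) = (x − qₙ)⋯(x − q₁) ∈ ℍ[x], where q₁, …, qₙ ∈ ℍ. If the conjugacy classes [q₁], …, [qₙ] are pairwise distinct, then P(x) has exactly n roots ζ₁, …, ζₙ in ℍ, given by ζₖ = P̄ₖ(qₖ) · qₖ · (P̄ₖ(qₖ))⁻¹ for k = 1, …, n, where Pₖ(x) = 1 if k = 1 and Pₖ(x) = (x − q_{k−1})⋯(x − q₁) otherwise, and P̄ₖ(x) = (x − q̄₁)⋯(x − q̄_{k−1}) is the conjugate polynomial of Pₖ(x) (here q̄ denotes quaternion conjugation). In particular, the set of roots of P(x) equals {ζ₁, …, ζₙ} and these n elements are pairwise distinct. -/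
open Polynomial

section Evaluation

variable {D : Type*} [DivisionRing D]

theorem conjClass_eq_of_mem {a b : D} (h : b ∈ conjClass a) : conjClass b = conjClass a := by
  obtain ⟨d, hd, rfl⟩ := h
  ext c
  constructor
  · rintro ⟨e, he, rfl⟩
    exact ⟨e * d, mul_ne_zero he hd, by simp only [mul_inv_rev, mul_assoc]⟩
  · rintro ⟨e, he, rfl⟩
    refine ⟨e * d⁻¹, mul_ne_zero he (inv_ne_zero hd), ?_⟩
    simp [mul_assoc, hd]

/-- Evaluation of a product when the coefficients do not commute with the point. -/
theorem eval_mul_eq_eval_conj_mul (f g : D[X]) (a : D) (hg : g.eval a ≠ 0) :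
    (f * g).eval a = f.eval (g.eval a * a * (g.eval a)⁻¹) * g.eval a := by
  have hpow (n : ℕ) :
      (g.eval a * a * (g.eval a)⁻¹) ^ n * g.eval a = g.eval a * a ^ n := by
    induction n with
    | zero => simp
    | succ n ih =>
      rw [pow_succ, mul_assoc, inv_mul_cancel_right₀ hg, ← mul_assoc, ih, mul_assoc, pow_succ]
  induction f using Polynomial.induction_on' with
  | add p q hp hq => simp [add_mul, hp, hq]
  | monomial n b =>
    rw [eval_monomial, mul_assoc, hpow, ← C_mul_X_pow_eq_monomial, mul_assoc, X_pow_mul, eval_C_mul,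
      eval_mul_X_pow]

theorem eval_mul_eq_zero_of_right (f g : D[X]) (a : D) (hg : g.eval a = 0) :
    (f * g).eval a = 0 := by
  induction f using Polynomial.induction_on' with
  | add p q hp hq => simp [add_mul, hp, hq]
  | monomial n b =>
    rw [← C_mul_X_pow_eq_monomial, mul_assoc, X_pow_mul, eval_C_mul, eval_mul_X_pow, hg]
    simp

end Evaluation

section Quaternions

open scoped Quaternion
open Quaternion (normSq self_add_star' self_mul_star star_mul_self)

theorem commute_map_algebraMap {R A : Type*} [CommSemiring R] [Semiring A] [Algebra R A]
    (p : R[X]) (f : A[X]) : Commute (p.map (algebraMap R A)) f := by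
  induction p using Polynomial.induction_on' with
  | add p q hp hq => simpa using hp.add_left hq
  | monomial n b =>
    rw [map_monomial, ← C_mul_X_pow_eq_monomial]
    exact (Algebra.commute_algebraMap_left (A := A[X]) b f).mul_left (commute_X_pow f n)

/-- The product of `x - q` and `x - q̄`, a real polynomial. -/
noncomputable def realQuadratic (q : ℍ[ℝ]) : ℝ[X] :=
  X ^ 2 - C (2 * q.re) * X + C (normSq q)

theorem X_sub_C_mul_X_sub_C_star (q : ℍ[ℝ]) :
    (X - C q) * (X - C (star q)) = (realQuadratic q).map (algebraMap ℝ ℍ[ℝ]) := by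
  have hadd : algebraMap ℝ ℍ[ℝ] (2 * q.re) = q + star q := (self_add_star' q).symm
  have hmul : algebraMap ℝ ℍ[ℝ] (normSq q) = q * star q := (self_mul_star q).symm
  rw [realQuadratic, Polynomial.map_add, Polynomial.map_sub, Polynomial.map_mul,
    Polynomial.map_pow, map_X, map_C, map_C, hadd, hmul, C_add, C_mul, sub_mul, mul_sub, mul_sub,
    add_mul, X_mul_C, sq]
  abel

theorem X_sub_C_star_mul_X_sub_C (q : ℍ[ℝ]) :
    (X - C (star q)) * (X - C q) = (realQuadratic q).map (algebraMap ℝ ℍ[ℝ]) := by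
  simpa [realQuadratic] using X_sub_C_mul_X_sub_C_star (star q)

theorem star_mem_conjClass (q : ℍ[ℝ]) : star q ∈ conjClass q := by
  suffices h : ∃ d : ℍ[ℝ], d ≠ 0 ∧ star q * d = d * q by
    obtain ⟨d, hd, h⟩ := h
    exact ⟨d, hd, by rw [← h, mul_inv_cancel_right₀ hd]⟩
  have hpure (x y : ℝ) : ∃ d : ℍ[ℝ], d.re = 0 ∧ d.imI = x ∧ d.imJ = y ∧ d.imK = 0 :=
    ⟨⟨0, x, y, 0⟩, rfl, rfl, rfl, rfl⟩
  by_cases h : q.imI = 0 ∧ q.imJ = 0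
  · obtain ⟨d, hr, hi, hj, hk⟩ := hpure 1 0
    refine ⟨d, ?_, ?_⟩
    · rintro rfl
      simp at hi
    · apply Quaternion.ext <;> simp [hr, hi, hj, hk, h]
  · obtain ⟨d, hr, hi, hj, hk⟩ := hpure (-q.imJ) q.imI
    refine ⟨d, ?_, ?_⟩
    · rintro rfl
      exact h ⟨hj.symm, neg_eq_zero.mp hi.symm⟩
    · apply Quaternion.ext <;> simp [hr, hi, hj, hk] <;> ring

theorem conjClass_eq_of_aeval_realQuadratic {a q : ℍ[ℝ]} (h : aeval a (realQuadratic q) = 0) :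
    conjClass a = conjClass q := by
  apply conjClass_eq_of_mem
  by_cases hd : a - star q = 0
  · rw [sub_eq_zero.mp hd]
    exact star_mem_conjClass q
  refine ⟨a - star q, hd, ?_⟩
  rw [eq_mul_inv_iff_mul_eq₀ hd, ← sub_eq_zero]
  have hadd : algebraMap ℝ ℍ[ℝ] (2 * q.re) = q + star q := (self_add_star' q).symm
  have hmul : algebraMap ℝ ℍ[ℝ] (normSq q) = star q * q := (star_mul_self q).symm
  have hcomm : algebraMap ℝ ℍ[ℝ] (2 * q.re) * a = a * (q + star q) := by
    rw [Algebra.commutes, hadd]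
  rw [realQuadratic, map_add, map_sub, map_mul, map_pow, aeval_X, aeval_C, aeval_C, hcomm,
    hmul] at h
  rw [← h]
  noncomm_ring

/-- The product `(x - qₙ)⋯(x - q₁)` for the list `[q₁, …, qₙ]`. -/
noncomputable def linearProd (L : List ℍ[ℝ]) : ℍ[ℝ][X] :=
  (L.map fun q => X - C q).reverse.prod

/-- The product `(x - q̄₁)⋯(x - q̄ₙ)` for the list `[q₁, …, qₙ]`. -/
noncomputable def conjLinearProd (L : List ℍ[ℝ]) : ℍ[ℝ][X] :=
  (L.map fun q => X - C (star q)).prod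

theorem linearProd_mul_conjLinearProd (L : List ℍ[ℝ]) :
    linearProd L * conjLinearProd L =
      (L.map realQuadratic).prod.map (algebraMap ℝ ℍ[ℝ]) := by
  induction L with
  | nil => simp [linearProd, conjLinearProd]
  | cons q L ih =>
    have hA : linearProd (q :: L) = linearProd L * (X - C q) := by simp [linearProd]
    have hB : conjLinearProd (q :: L) = (X - C (star q)) * conjLinearProd L := by
      simp [conjLinearProd]
    rw [hA, hB, mul_assoc, ← mul_assoc (X - C q), X_sub_C_mul_X_sub_C_star, ← mul_assoc,
      ← (commute_map_algebraMap _ (linearProd L)).eq, mul_assoc, ih, ← Polynomial.map_mul,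
      List.map_cons, List.prod_cons]

theorem conjLinearProd_mul_linearProd (L : List ℍ[ℝ]) :
    conjLinearProd L * linearProd L =
      (L.map realQuadratic).prod.map (algebraMap ℝ ℍ[ℝ]) := by
  induction L with
  | nil => simp [linearProd, conjLinearProd]
  | cons q L ih =>
    have hA : linearProd (q :: L) = linearProd L * (X - C q) := by simp [linearProd]
    have hB : conjLinearProd (q :: L) = (X - C (star q)) * conjLinearProd L := by
      simp [conjLinearProd]
    rw [hA, hB, mul_assoc, ← mul_assoc (conjLinearProd L), ih,
      (commute_map_algebraMap _ (X - C q)).eq, ← mul_assoc, X_sub_C_star_mul_X_sub_C,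
      ← Polynomial.map_mul, List.map_cons, List.prod_cons]

theorem aeval_prod_realQuadratic_ne_zero {L : List ℍ[ℝ]} {a : ℍ[ℝ]}
    (h : ∀ q ∈ L, conjClass a ≠ conjClass q) : aeval a (L.map realQuadratic).prod ≠ 0 := by
  rw [map_list_prod, List.map_map]
  apply List.prod_ne_zero
  simp only [List.mem_map, not_exists, not_and, Function.comp_apply]
  exact fun q hq h0 => h q hq (conjClass_eq_of_aeval_realQuadratic h0)

theorem eval_conjLinearProd_ne_zero {L : List ℍ[ℝ]} {a : ℍ[ℝ]}
    (h : ∀ q ∈ L, conjClass a ≠ conjClass q) : (conjLinearProd L).eval a ≠ 0 := by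
  intro h0
  apply aeval_prod_realQuadratic_ne_zero h
  rw [← eval_map_algebraMap, ← linearProd_mul_conjLinearProd]
  exact eval_mul_eq_zero_of_right _ _ _ h0

theorem eval_X_sub_C_mul_linearProd_eq_zero_iff {L : List ℍ[ℝ]} {a : ℍ[ℝ]}
    (h : ∀ q ∈ L, conjClass a ≠ conjClass q) (r : ℍ[ℝ]) :
    ((X - C a) * linearProd L).eval r = 0 ↔ (linearProd L).eval r = 0 ∨
      r = (conjLinearProd L).eval a * a * ((conjLinearProd L).eval a)⁻¹ := by
  have hB := eval_conjLinearProd_ne_zero h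
  have hN := aeval_prod_realQuadratic_ne_zero h
  set b := (conjLinearProd L).eval a with hb
  have hcomm (s : ℍ[ℝ]) : Commute (aeval s (L.map realQuadratic).prod) s := by
    simpa using (commute_X (L.map realQuadratic).prod).symm.map (aeval s)
  by_cases hu : (linearProd L).eval r = 0
  · simp [hu, eval_mul_eq_zero_of_right]
  rw [eval_mul_eq_eval_conj_mul _ _ _ hu]
  simp only [hu, mul_eq_zero, or_false, false_or, eval_sub, eval_X, eval_C, sub_eq_zero]
  set u := (linearProd L).eval r
  constructor
  · intro hr
    have hNr : aeval r (L.map realQuadratic).prod = b * u := by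
      rw [← eval_map_algebraMap, ← conjLinearProd_mul_linearProd,
        eval_mul_eq_eval_conj_mul _ _ _ hu, hr]
    have := (hcomm r).eq
    rw [hNr] at this
    rw [eq_mul_inv_iff_mul_eq₀ hB, ← hr]
    rw [← mul_assoc, ← mul_assoc, this, ← mul_assoc, mul_inv_cancel_right₀ hu]
  · intro hr
    have hNa : aeval a (L.map realQuadratic).prod = u * b := by
      rw [← eval_map_algebraMap, ← linearProd_mul_conjLinearProd,
        eval_mul_eq_eval_conj_mul _ _ _ hB, ← hb, ← hr]
    have := (hcomm a).eq
    rw [hNa] at this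
    rw [mul_inv_eq_iff_eq_mul₀ hu, hr, ← mul_assoc, ← mul_assoc, this, ← mul_assoc,
      mul_inv_cancel_right₀ hB]

theorem setOf_eval_linearProd_ofFn_eq_zero (n : ℕ) (q : Fin n → ℍ[ℝ])
    (hdist : ∀ i j : Fin n, i ≠ j → conjClass (q i) ≠ conjClass (q j)) (r : ℍ[ℝ]) :
    (linearProd (List.ofFn q)).eval r = 0 ↔ ∃ k : Fin n,
      r = (conjLinearProd (List.ofFn fun i : Fin k => q ⟨i, i.isLt.trans k.isLt⟩)).eval (q k) *
        q k *
        ((conjLinearProd (List.ofFn fun i : Fin k => q ⟨i, i.isLt.trans k.isLt⟩)).eval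
          (q k))⁻¹ := by
  induction n with
  | zero => simp [linearProd]
  | succ n ih =>
    have hA : linearProd (List.ofFn q) =
        (X - C (q (Fin.last n))) * linearProd (List.ofFn fun i : Fin n => q i.castSucc) := by
      simp [linearProd, List.ofFn_succ', -List.ofFn_succ]
    rw [hA, eval_X_sub_C_mul_linearProd_eq_zero_iff, ih, Fin.exists_fin_succ']
    · rfl
    · exact fun i j hij => hdist _ _ (by simpa using hij)
    · simp only [List.mem_ofFn, forall_exists_index]
      rintro _ i rfl
      exact hdist _ _ (Fin.castSucc_lt_last i).ne'

end Quaternions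

/-- **Theorem (roots of a product of linear factors over the quaternions).**
Let `P(x) = (x − qₙ)⋯(x − q₁) ∈ ℍ[x]`.  If the conjugacy classes `[qₖ]` are pairwise
distinct, then `P` has exactly `n` roots `ζₖ = P̄ₖ(qₖ) qₖ (P̄ₖ(qₖ))⁻¹`, where
`P̄ₖ(x) = (x − q̄₁)⋯(x − q̄ₖ₋₁)` is the conjugate polynomial of
`Pₖ(x) = (x − qₖ₋₁)⋯(x − q₁)` (and `P̄₁ = 1`); i.e. the set of roots of `P`
is `{ζ₁, …, ζₙ}` and the `ζₖ` are pairwise distinct. -/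
theorem roots_of_linear_factors_quaternions (n : ℕ) (q : Fin n → Quaternion ℝ)
    (hdist : ∀ i j : Fin n, i ≠ j → conjClass (q i) ≠ conjClass (q j))
    (P : Polynomial (Quaternion ℝ))
    (hP : P = ((List.ofFn fun i : Fin n => X - C (q i)).reverse).prod)
    (Pbar : Fin n → Polynomial (Quaternion ℝ))
    (hPbar : ∀ k : Fin n,
      Pbar k = (List.ofFn fun i : Fin k => X - C (star (q ⟨i, i.isLt.trans k.isLt⟩))).prod)
    (ζ : Fin n → Quaternion ℝ)
    (hζ : ∀ k : Fin n, ζ k = (Pbar k).eval (q k) * q k * ((Pbar k).eval (q k))⁻¹) :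
    Function.Injective ζ ∧ {r : Quaternion ℝ | P.eval r = 0} = Set.range ζ := by
  have hPbar' (k : Fin n) : Pbar k =
      conjLinearProd (List.ofFn fun i : Fin k => q ⟨i, i.isLt.trans k.isLt⟩) := by
    rw [hPbar, conjLinearProd, List.map_ofFn]
    rfl
  have hP' : P = linearProd (List.ofFn q) := by
    rw [hP, linearProd, List.map_ofFn]
    rfl
  have hmem (k : Fin n) : ζ k ∈ conjClass (q k) := by
    refine ⟨_, ?_, hζ k⟩
    rw [hPbar']
    apply eval_conjLinearProd_ne_zero
    simp only [List.mem_ofFn, forall_exists_index]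
    rintro _ i rfl
    exact hdist _ _ (Fin.ne_of_gt i.isLt)
  refine ⟨fun i j hij => ?_, ?_⟩
  · by_contra hne
    apply hdist i j hne
    rw [← conjClass_eq_of_mem (hmem i), ← conjClass_eq_of_mem (hmem j), hij]
  · ext r
    rw [Set.mem_ofPred_eq, hP', setOf_eval_linearProd_ofFn_eq_zero n q hdist]
    simp only [Set.mem_range, hζ, hPbar', eq_comm]
end

section
/- Let D be a division ring with center F, and let A be a conjugacy class of D whose elements are algebraic over F with a quadratic minimal polynomial λ(x) ∈ F[x]. If a polynomial P(x) ∈ D[x] has two distinct roots in A, then P(x) = Q(x)·λ(x) for some Q(x) ∈ D[x], and P(x) vanishes identically on A (i.e., every element of A is a root of P(x)). -/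
open Polynomial

/-- Conjugate elements are roots of the same polynomials with central coefficients. -/
theorem aeval_eq_zero_of_mem_conjClass {D : Type*} [DivisionRing D] {a c : D}
    (hc : c ∈ conjClass a) {p : Polynomial (Subring.center D)} (hp : aeval a p = 0) :
    aeval c p = 0 := by
  obtain ⟨d, hd, rfl⟩ := hc
  have key : aeval (d * a * d⁻¹) p = d * aeval a p * d⁻¹ := by
    clear hp
    induction p using Polynomial.induction_on' with
    | add p q hp hq => simp only [map_add, hp, hq, mul_add, add_mul]
    | monomial n k =>
      have hpow : (d * a * d⁻¹) ^ n = d * a ^ n * d⁻¹ := Units.conj_pow (Units.mk0 d hd) a n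
      rw [aeval_monomial, aeval_monomial, hpow, ← mul_assoc d, ← Algebra.commutes k d]
      simp only [mul_assoc]
  rw [key, hp, mul_zero, zero_mul]

/-- Evaluation is multiplicative when the right factor has central coefficients. -/
theorem eval_mul_map_center {D : Type*} [DivisionRing D] (Q : Polynomial D)
    (p : Polynomial (Subring.center D)) (c : D) :
    (Q * p.map (algebraMap (Subring.center D) D)).eval c = Q.eval c * aeval c p := by
  rw [aeval_def, ← eval_map]
  refine eval₂_mul_noncomm (RingHom.id D) c fun k => ?_
  rw [coeff_map]
  exact Algebra.commutes (p.coeff k) c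

/-- Polynomials with central coefficients are central. -/
theorem commute_map_center {D : Type*} [DivisionRing D] (p : Polynomial (Subring.center D))
    (Q : Polynomial D) : Commute (p.map (algebraMap (Subring.center D) D)) Q := by
  induction p using Polynomial.induction_on' with
  | add p q hp hq => simpa only [Polynomial.map_add] using hp.add_left hq
  | monomial n k =>
    rw [map_monomial, ← C_mul_X_pow_eq_monomial]
    refine Commute.mul_left ?_ (commute_X_pow Q n)
    ext m
    rw [coeff_C_mul, coeff_mul_C]
    exact Algebra.commutes k _

/-- A polynomial of degree less than two with two distinct roots is zero. -/
theorem eq_zero_of_degree_lt_two_of_eval_eq_zero {D : Type*} [DivisionRing D] {R : Polynomial D}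
    (hR : R.degree < 2) {r s : D} (hne : r ≠ s) (hr : R.eval r = 0) (hs : R.eval s = 0) :
    R = 0 := by
  have hform : R = C (R.coeff 1) * X + C (R.coeff 0) :=
    eq_X_add_C_of_degree_le_one (Order.le_of_lt_succ hR)
  generalize R.coeff 1 = u at hform
  generalize R.coeff 0 = v at hform
  subst hform
  simp only [eval_add, eval_C_mul, eval_X, eval_C] at hr hs
  have hu : u = 0 := by
    have : u * (r - s) = 0 := by
      rw [mul_sub, sub_eq_zero]
      exact add_right_cancel (hr.trans hs.symm)
    exact (mul_eq_zero.mp this).resolve_right (sub_ne_zero.mpr hne)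
  have hv : v = 0 := by simpa [hu] using hr
  simp [hu, hv]

/-- **Theorem (two roots in a class with quadratic minimal polynomial).**
Let `D` be a division ring with center `F`, and let `A = [a]` be a conjugacy class whose
elements are algebraic over `F` with quadratic minimal polynomial `λ(x) ∈ F[x]`.
If `P(x) ∈ D[x]` has two distinct roots in `A`, then `P(x) = Q(x)·λ(x)` for some
`Q(x) ∈ D[x]`, and `P` vanishes identically on `A`. -/
theorem two_roots_quadratic_minpoly {D : Type*} [DivisionRing D]
    (a : D) (ha : IsIntegral (Subring.center D) a)
    (hquad : (minpoly (Subring.center D) a).natDegree = 2)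
    (P : Polynomial D) (r₁ r₂ : D)
    (hr₁ : r₁ ∈ conjClass a) (hr₂ : r₂ ∈ conjClass a) (hne : r₁ ≠ r₂)
    (h₁ : P.eval r₁ = 0) (h₂ : P.eval r₂ = 0) :
    (∃ Q : Polynomial D,
      P = Q * (minpoly (Subring.center D) a).map (algebraMap (Subring.center D) D)) ∧
    ∀ c ∈ conjClass a, P.eval c = 0 := by
  set p := minpoly (Subring.center D) a with hp
  set L := p.map (algebraMap (Subring.center D) D) with hL
  have hmonic : L.Monic := (minpoly.monic ha).map _
  have hroot : ∀ c ∈ conjClass a, aeval c p = 0 := fun c hc =>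
    aeval_eq_zero_of_mem_conjClass hc (minpoly.aeval _ a)
  have hdiv : P %ₘ L + (P /ₘ L) * L = P := by
    rw [← (commute_map_center p (P /ₘ L)).eq]
    exact modByMonic_add_div P L
  have heval : ∀ c ∈ conjClass a, P.eval c = (P %ₘ L).eval c := fun c hc => by
    conv_lhs => rw [← hdiv]
    rw [eval_add, hL, eval_mul_map_center, hroot c hc, mul_zero, add_zero]
  have hdeg : (P %ₘ L).degree < 2 := by
    refine (degree_modByMonic_lt P hmonic).trans_eq ?_
    rw [degree_eq_natDegree hmonic.ne_zero, (minpoly.monic ha).natDegree_map, hquad]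
    rfl
  have hzero : P %ₘ L = 0 :=
    eq_zero_of_degree_lt_two_of_eval_eq_zero hdeg hne
      ((heval r₁ hr₁).symm.trans h₁) ((heval r₂ hr₂).symm.trans h₂)
  refine ⟨⟨P /ₘ L, ?_⟩, fun c hc => by rw [heval c hc, hzero, eval_zero]⟩
  rw [hzero, zero_add] at hdiv
  exact hdiv.symm
end

section
/- Let D be a division ring with center F, and let A be a conjugacy class of D whose elements are algebraic over F with minimal polynomial f(x) ∈ F[x]. A polynomial P(x) ∈ D[x] vanishes identically on A (i.e., P(a) = 0 for every a ∈ A) if and only if P(x) = Q(x)·f(x) for some Q(x) ∈ D[x]. -/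
open Polynomial

/-- The inner automorphism `x ↦ d * x * d⁻¹` of a division ring, as a ring homomorphism. -/
def conjHom {D : Type*} [DivisionRing D] (d : D) (hd : d ≠ 0) : D →+* D where
  toFun x := d * x * d⁻¹
  map_one' := by simp [hd]
  map_mul' x y := by simp [mul_assoc, hd]
  map_zero' := by simp
  map_add' x y := by simp [mul_add, add_mul]

theorem conjHom_apply {D : Type*} [DivisionRing D] (d : D) (hd : d ≠ 0) (x : D) :
    conjHom d hd x = d * x * d⁻¹ := rfl

theorem conjHom_eq_self_iff {D : Type*} [DivisionRing D] (d : D) (hd : d ≠ 0) (x : D) :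
    conjHom d hd x = x ↔ d * x = x * d := by
  rw [conjHom_apply, mul_inv_eq_iff_eq_mul₀ hd]

theorem self_mem_conjClass {D : Type*} [DivisionRing D] (a : D) : a ∈ conjClass a :=
  ⟨1, one_ne_zero, by simp⟩

theorem conjHom_mem_conjClass {D : Type*} [DivisionRing D] {a c : D} (d : D) (hd : d ≠ 0)
    (hc : c ∈ conjClass a) : conjHom d hd c ∈ conjClass a := by
  obtain ⟨e, he, rfl⟩ := hc
  exact ⟨d * e, mul_ne_zero hd he, by simp [conjHom_apply, mul_assoc]⟩

theorem conjHom_conjHom_inv {D : Type*} [DivisionRing D] (d : D) (hd : d ≠ 0) (x : D) :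
    conjHom d hd (conjHom d⁻¹ (inv_ne_zero hd) x) = x := by
  simp [conjHom_apply, mul_assoc, hd]

theorem eval_map_conjHom_eq_zero {D : Type*} [DivisionRing D] {a : D} {P : D[X]}
    (hP : ∀ c ∈ conjClass a, P.eval c = 0) (d : D) (hd : d ≠ 0) :
    ∀ c ∈ conjClass a, (P.map (conjHom d hd)).eval c = 0 := by
  intro c hc
  rw [← conjHom_conjHom_inv d hd c, eval_map_apply,
    hP _ (conjHom_mem_conjClass _ _ hc), map_zero]

theorem map_algebraMap_center_commute {D : Type*} [DivisionRing D]
    (g : (Subring.center D)[X]) (Q : D[X]) :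
    Commute (g.map (algebraMap (Subring.center D) D)) Q := by
  induction g using Polynomial.induction_on' with
  | add p q hp hq => simpa using hp.add_left hq
  | monomial n z =>
    rw [map_monomial, ← C_mul_X_pow_eq_monomial]
    refine Commute.mul_left ?_ (commute_X_pow Q n)
    ext k
    rw [coeff_C_mul, coeff_mul_C]
    exact Subring.mem_center_iff.mp z.2 _ |>.symm

theorem eval_mul_map_algebraMap_center {D : Type*} [DivisionRing D]
    (Q : D[X]) (g : (Subring.center D)[X]) (c : D) :
    (Q * g.map (algebraMap (Subring.center D) D)).eval c =
      Q.eval c * (g.map (algebraMap (Subring.center D) D)).eval c := by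
  refine eval₂_mul_noncomm _ _ fun k => ?_
  rw [coeff_map]
  exact (Subring.mem_center_iff.mp (g.coeff k).2 c).symm

theorem eval_minpoly_eq_zero_of_mem_conjClass {D : Type*} [DivisionRing D] {a c : D}
    (hc : c ∈ conjClass a) :
    ((minpoly (Subring.center D) a).map (algebraMap (Subring.center D) D)).eval c = 0 := by
  obtain ⟨d, hd, rfl⟩ := hc
  have hfix : (conjHom d hd).comp (algebraMap (Subring.center D) D) =
      algebraMap (Subring.center D) D := by
    ext z
    exact (conjHom_eq_self_iff d hd _).mpr (Subring.mem_center_iff.mp z.2 d)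
  rw [← conjHom_apply d hd, ← hfix, ← Polynomial.map_map, eval_map_apply, eval_map_algebraMap,
    minpoly.aeval, map_zero]

/-- A nonzero polynomial vanishing on a conjugacy class has degree at least that of the minimal
polynomial of the class. -/
theorem natDegree_minpoly_le_of_vanishes {D : Type*} [DivisionRing D] {a : D} {P : D[X]}
    (hP0 : P ≠ 0) (hP : ∀ c ∈ conjClass a, P.eval c = 0) :
    (minpoly (Subring.center D) a).natDegree ≤ P.natDegree := by
  induction hn : P.natDegree using Nat.strong_induction_on generalizing P with
  | _ n ih =>
  have hlc : P.leadingCoeff ≠ 0 := leadingCoeff_ne_zero.mpr hP0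
  set R : D[X] := C P.leadingCoeff⁻¹ * P with hR
  have hRdeg : R.natDegree = n := by rw [hR, natDegree_C_mul (inv_ne_zero hlc), hn]
  have hRmonic : R.Monic := by
    rw [Monic, hR, leadingCoeff_mul, leadingCoeff_C, inv_mul_cancel₀ hlc]
  have hRvan : ∀ c ∈ conjClass a, R.eval c = 0 := fun c hc => by
    rw [hR, eval_C_mul, hP c hc, mul_zero]
  by_cases hfix : ∀ (d : D) (hd : d ≠ 0), R.map (conjHom d hd) = R
  · have hlift : R ∈ lifts (algebraMap (Subring.center D) D) := by
      refine (lifts_iff_coeff_lifts R).mpr fun k => ?_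
      refine ⟨⟨R.coeff k, Subring.mem_center_iff.mpr fun d => ?_⟩, rfl⟩
      by_cases hd : d = 0
      · simp [hd]
      · rw [← conjHom_eq_self_iff d hd, ← coeff_map, hfix d hd]
    obtain ⟨g, hgR, hgdeg, hgmonic⟩ := lifts_and_natDegree_eq_and_monic hlift hRmonic
    rw [← hRdeg, ← hgdeg]
    refine natDegree_le_natDegree (minpoly.min _ _ hgmonic ?_)
    rw [← eval_map_algebraMap, hgR]
    exact hRvan a (self_mem_conjClass a)
  · push Not at hfix
    obtain ⟨d, hd, hne⟩ := hfix
    have hS0 : R.map (conjHom d hd) - R ≠ 0 := sub_ne_zero.mpr hne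
    have hdeg : (R.map (conjHom d hd) - R).natDegree < n := by
      rw [← hRdeg]
      refine natDegree_lt_natDegree hS0 ?_
      have := degree_sub_lt_left (p := R.map (conjHom d hd)) (q := R) (by simp)
        (hRmonic.map _).ne_zero (by rw [(hRmonic.map _).leadingCoeff, hRmonic.leadingCoeff])
      simpa using this
    refine (ih _ hdeg hS0 (fun c hc => ?_) rfl).trans hdeg.le
    rw [eval_sub, eval_map_conjHom_eq_zero hRvan d hd c hc, hRvan c hc, sub_zero]

/-- **Theorem (vanishing on a conjugacy class).**
Let `D` be a division ring with center `F` and let `A = [a]` be a conjugacy class whose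
elements are algebraic over `F` with minimal polynomial `f(x) ∈ F[x]`.  A polynomial
`P(x) ∈ D[x]` vanishes identically on `A` iff `P(x) = Q(x)·f(x)` for some `Q(x) ∈ D[x]`. -/
theorem vanishes_on_class_iff {D : Type*} [DivisionRing D]
    (a : D) (ha : IsIntegral (Subring.center D) a)
    (P : Polynomial D) :
    (∀ c ∈ conjClass a, P.eval c = 0) ↔
    ∃ Q : Polynomial D,
      P = Q * (minpoly (Subring.center D) a).map (algebraMap (Subring.center D) D) := by
  set f := (minpoly (Subring.center D) a).map (algebraMap (Subring.center D) D) with hf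
  constructor
  · intro hP
    have hmonic : f.Monic := (minpoly.monic ha).map _
    have hdecomp : P %ₘ f + P /ₘ f * f = P := by
      rw [← (map_algebraMap_center_commute (minpoly (Subring.center D) a) (P /ₘ f)).eq]
      exact modByMonic_add_div P f
    have hrem : P %ₘ f = 0 := by
      by_contra h0
      have hvan : ∀ c ∈ conjClass a, (P %ₘ f).eval c = 0 := fun c hc => by
        have h := congrArg (eval c) hdecomp
        rwa [eval_add, hf, eval_mul_map_algebraMap_center,
          eval_minpoly_eq_zero_of_mem_conjClass hc, mul_zero, add_zero, hP c hc] at h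
      have hle := natDegree_minpoly_le_of_vanishes h0 hvan
      have hlt := natDegree_lt_natDegree h0 (degree_modByMonic_lt P hmonic)
      rw [hf, (minpoly.monic ha).natDegree_map] at hlt
      exact absurd hlt hle.not_gt
    exact ⟨P /ₘ f, by rw [← zero_add (P /ₘ f * f), ← hrem, hdecomp]⟩
  · rintro ⟨Q, rfl⟩ c hc
    rw [hf, eval_mul_map_algebraMap_center, eval_minpoly_eq_zero_of_mem_conjClass hc, mul_zero]
end

section
/- Let D be a division ring. If a polynomial P(x) ∈ D[x] has two distinct roots lying in the same conjugacy class of D, then P(x) has infinitely many roots in that conjugacy class. -/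
open Polynomial

theorem Module.End.finite_ker_mul {R V : Type*} [Ring R] [AddCommGroup V] [Module R V]
    {f g : Module.End R V} (hf : (LinearMap.ker f : Set V).Finite)
    (hg : (LinearMap.ker g : Set V).Finite) : (LinearMap.ker (f * g) : Set V).Finite := by
  have key : (LinearMap.ker (f * g) : Set V) = g ⁻¹' (LinearMap.ker f : Set V) := by
    ext x
    simp
  rw [key]
  refine hf.preimage' fun b _ => ?_
  rcases (g ⁻¹' {b}).eq_empty_or_nonempty with h | ⟨x, hx⟩
  · simp [h]
  · refine (hg.image (x + ·)).subset fun y hy => ⟨y - x, ?_, by simp⟩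
    simp only [Set.mem_preimage, Set.mem_singleton_iff] at hx hy
    simp [hx, hy]

/-- An endomorphism `f` over a finite field `K` satisfying `f ^ |K| = f`, all of whose eigenspaces
are finite, acts on a finite space. -/
theorem Module.End.finite_of_pow_card_eq_self {K V : Type*} [Field K] [Finite K] [AddCommGroup V]
    [Module K V] (f : Module.End K V) (hf : f ^ Nat.card K = f)
    (hker : ∀ c : K, (LinearMap.ker (f - algebraMap K _ c) : Set V).Finite) : Finite V := by
  have := Fintype.ofFinite K
  have hcard : 1 < Fintype.card K := Fintype.one_lt_card
  have hprod : ((Finset.univ.val : Multiset K).map fun c => X - C c).prod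
      = X ^ Fintype.card K - X := by
    rw [← FiniteField.roots_X_pow_card_sub_X K]
    refine prod_multiset_X_sub_C_of_monic_of_roots_card_eq ?_ ?_
    · exact monic_X_pow_sub (by rw [degree_X]; exact_mod_cast hcard)
    · rw [FiniteField.roots_X_pow_card_sub_X, FiniteField.X_pow_card_sub_X_natDegree_eq K hcard]
      rfl
  have hfin : ∀ s : Multiset K,
      (LinearMap.ker (aeval f (s.map fun c => X - C c).prod) : Set V).Finite := by
    intro s
    induction s using Multiset.induction with
    | empty => simp [Module.End.one_eq_id]
    | cons c s ih =>
      rw [Multiset.map_cons, Multiset.prod_cons, map_mul]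
      refine Module.End.finite_ker_mul ?_ ih
      simpa using hker c
  have h := hfin Finset.univ.val
  rw [hprod] at h
  rw [Nat.card_eq_fintype_card] at hf
  simpa [hf, Set.finite_univ_iff] using h

section DivisionRing

variable {D : Type*} [DivisionRing D]

theorem finite_setOf_mul_eq_mul {a : D} (h : {x : D | Commute a x}.Finite) (c : D) :
    {d : D | d * a = c * d}.Finite := by
  by_cases h0 : ∃ d₀ : D, d₀ ≠ 0 ∧ d₀ * a = c * d₀
  · obtain ⟨d₀, hd₀, e₀⟩ := h0
    refine (h.image (d₀ * ·)).subset fun d hd => ⟨d₀⁻¹ * d, ?_, by simp [hd₀]⟩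
    have hd : d * a = c * d := hd
    have e : a * d₀⁻¹ = d₀⁻¹ * c := by
      rw [mul_inv_eq_iff_eq_mul₀ hd₀, mul_assoc, ← e₀, inv_mul_cancel_left₀ hd₀]
    change a * (d₀⁻¹ * d) = d₀⁻¹ * d * a
    rw [← mul_assoc, e, mul_assoc, mul_assoc, hd]
  · push Not at h0
    refine (Set.finite_singleton (0 : D)).subset fun d hd => ?_
    by_contra hne
    exact h0 d hne hd

open scoped IsMulCommutative in
/-- A division ring containing an element with finite centralizer is finite. -/
theorem DivisionRing.finite_of_finite_centralizer {a : D} (h : {x : D | Commute a x}.Finite) :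
    Finite D := by
  let R := Subring.closure {a}
  have : IsMulCommutative R := Subring.isMulCommutative_closure (by simp)
  have hle : R ≤ Subring.centralizer {a} :=
    Subring.closure_le.2 (by simp [Set.mem_centralizer_iff])
  have hR : Finite R := (h.subset fun x hx =>
    Subring.mem_centralizer_iff.1 (hle hx) a rfl : (R : Set D).Finite)
  let _ : Field R := (Finite.isField_of_domain R).toField
  let f : Module.End R D :=
    { toFun := fun d => d * a
      map_add' := fun x y => add_mul x y a
      map_smul' := fun r x => mul_assoc (r : D) x a }
  have hpow : ∀ n d, (f ^ n) d = d * a ^ n := by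
    intro n
    induction n with
    | zero => simp
    | succ n ih =>
      intro d
      rw [pow_succ, Module.End.mul_apply, ih]
      exact (mul_assoc _ _ _).trans (by rw [pow_succ'])
  refine Module.End.finite_of_pow_card_eq_self f ?_ fun c => ?_
  · have := Fintype.ofFinite R
    ext d
    rw [hpow, Nat.card_eq_fintype_card]
    have ha : (⟨a, Subring.subset_closure rfl⟩ : R) ^ Fintype.card R = ⟨a, _⟩ :=
      FiniteField.pow_card _
    exact congrArg (d * ·) (congrArg Subtype.val ha)
  · refine (finite_setOf_mul_eq_mul h c).subset fun d hd => ?_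
    exact sub_eq_zero.1 (LinearMap.mem_ker.1 hd)

theorem Polynomial.eval_conj_mul (P : D[X]) (a : D) {d : D} (hd : d ≠ 0) :
    P.eval (d * a * d⁻¹) * d = P.sum fun i c => c * d * a ^ i := by
  rw [eval_eq_sum, sum_def, sum_def, Finset.sum_mul]
  refine Finset.sum_congr rfl fun i _ => ?_
  have h : SemiconjBy d a (d * a * d⁻¹) := (inv_mul_cancel_right₀ hd _).symm
  rw [mul_assoc, ← (h.pow_right i).eq, ← mul_assoc]

theorem commute_inv_mul_of_conj_eq {a x y : D} (hx : x ≠ 0) (hy : y ≠ 0)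
    (h : x * a * x⁻¹ = y * a * y⁻¹) : Commute a (y⁻¹ * x) := by
  have h' : x * a = y * a * y⁻¹ * x := by rw [← h, inv_mul_cancel_right₀ hx]
  change a * (y⁻¹ * x) = y⁻¹ * x * a
  rw [mul_assoc y⁻¹, h']
  simp [mul_assoc, hy]

/-- If `t` does not commute with `a`, the conjugates of `a` by `d * (t + c)`, for `c` in the
centralizer of `a`, are pairwise distinct. -/
theorem injOn_conj_mul_add {a t d : D} (hd : d ≠ 0) (ht : ¬ Commute a t) :
    Set.InjOn (fun c => d * (t + c) * a * (d * (t + c))⁻¹) {c | Commute a c} := by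
  have hne : ∀ c, Commute a c → t + c ≠ 0 := fun c hc h0 =>
    ht (by rw [eq_neg_of_add_eq_zero_left h0]; exact hc.neg_right)
  intro c hc c' hc' h
  have hk := commute_inv_mul_of_conj_eq (mul_ne_zero hd (hne c hc))
    (mul_ne_zero hd (hne c' hc')) h
  rw [mul_inv_rev, mul_assoc, inv_mul_cancel_left₀ hd] at hk
  set k := (t + c')⁻¹ * (t + c) with hkdef
  have e : t + c = (t + c') * k := (mul_inv_cancel_left₀ (hne c' hc') _).symm
  by_cases h1 : k = 1
  · simpa [h1] using e
  · have h1' : 1 - k ≠ 0 := sub_ne_zero.2 (Ne.symm h1)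
    have e' : t * (1 - k) = c' * k - c := by
      rw [mul_sub, mul_one, sub_eq_sub_iff_add_eq_add, e, add_mul, add_comm]
    refine absurd ?_ ht
    rw [(eq_mul_inv_iff_mul_eq₀ h1').2 e']
    exact ((hc'.mul_right hk).sub_right hc).mul_right
      (((Commute.one_right a).sub_right hk).inv_right₀)

end DivisionRing

/-- **Theorem (two roots in a class imply infinitely many).**
Let `D` be a division ring.  If `P(x) ∈ D[x]` has two distinct roots lying in the same
conjugacy class of `D`, then `P` has infinitely many roots in that conjugacy class. -/
theorem infinitely_many_roots_in_class {D : Type*} [DivisionRing D]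
    (P : Polynomial D) (a r₁ r₂ : D)
    (hr₁ : r₁ ∈ conjClass a) (hr₂ : r₂ ∈ conjClass a) (hne : r₁ ≠ r₂)
    (h₁ : P.eval r₁ = 0) (h₂ : P.eval r₂ = 0) :
    {r : D | r ∈ conjClass a ∧ P.eval r = 0}.Infinite := by
  obtain ⟨d₁, hd₁, rfl⟩ := hr₁
  obtain ⟨d₂, hd₂, rfl⟩ := hr₂
  have hinf : {x : D | Commute a x}.Infinite := fun hfin => by
    have := DivisionRing.finite_of_finite_centralizer hfin
    have hcomm : ∀ x y : D, x * y = y * x := (littleWedderburn D).mul_comm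
    refine hne ?_
    rw [hcomm d₁, hcomm d₂, mul_inv_cancel_right₀ hd₁, mul_inv_cancel_right₀ hd₂]
  have ht : ¬ Commute a (d₂⁻¹ * d₁) := fun h => by
    have e : d₁ * a = d₂ * a * (d₂⁻¹ * d₁) := by
      rw [mul_assoc, h.eq, ← mul_assoc, mul_inv_cancel_left₀ hd₂]
    refine hne ?_
    rw [e, mul_assoc, mul_assoc d₂⁻¹, mul_inv_cancel₀ hd₁, mul_one]
  refine (hinf.image (injOn_conj_mul_add hd₂ ht)).mono ?_
  rintro _ ⟨c, hc, rfl⟩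
  have hc : Commute a c := hc
  have h0 : d₂ * (d₂⁻¹ * d₁ + c) ≠ 0 := mul_ne_zero hd₂ fun h0 =>
    ht (by rw [eq_neg_of_add_eq_zero_left h0]; exact hc.neg_right)
  refine ⟨⟨_, h0, rfl⟩, (mul_eq_zero.1 ?_).resolve_right h0⟩
  have e₁ := P.eval_conj_mul a hd₁
  have e₂ := P.eval_conj_mul a hd₂
  rw [h₁, zero_mul, sum_def] at e₁
  rw [h₂, zero_mul, sum_def] at e₂
  rw [P.eval_conj_mul a h0, sum_def, mul_add d₂, mul_inv_cancel_left₀ hd₂]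
  have hsplit : ∀ i, P.coeff i * (d₁ + d₂ * c) * a ^ i
      = P.coeff i * d₁ * a ^ i + P.coeff i * d₂ * a ^ i * c := fun i => by
    rw [mul_add, add_mul, mul_assoc _ (a ^ i) c, (hc.pow_left i).eq]
    simp only [mul_assoc]
  simp only [hsplit]
  rw [Finset.sum_add_distrib, ← Finset.sum_mul, ← e₁, ← e₂, zero_mul, add_zero]
end

section
/- Let D be a division ring and let P(x) = L(x)·R(x) in D[x]. Let d ∈ D be such that h := R(d) ≠ 0. Then P(d) = L(hdh⁻¹)·R(d). In particular, if d is a root of P(x) but not of R(x), then hdh⁻¹ is a root of L(x). -/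
open Polynomial

/-- If `R(d)` intertwines `d` with `e`, then `(L * R)(d) = L(e) * R(d)`. -/
theorem Polynomial.eval_mul_of_semiconjBy {A : Type*} [Semiring A] (L R : A[X]) {d e : A}
    (hde : SemiconjBy (R.eval d) d e) : (L * R).eval d = L.eval e * R.eval d := by
  induction L using Polynomial.induction_on' with
  | add p q hp hq => rw [add_mul, eval_add, hp, hq, eval_add, add_mul]
  | monomial n a =>
    rw [← C_mul_X_pow_eq_monomial, mul_assoc, X_pow_mul, eval_C_mul, eval_mul_X_pow,
      C_mul_X_pow_eq_monomial, eval_monomial, (hde.pow_right n).eq, mul_assoc]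

/-- **Proposition (product evaluation formula).**
Let `D` be a division ring and `P(x) = L(x)·R(x)` in `D[x]`.  If `d ∈ D` and
`h := R(d) ≠ 0`, then `P(d) = L(h d h⁻¹)·R(d)`.  In particular, if `d` is a root of
`P` but not of `R`, then `h d h⁻¹` is a root of `L`. -/
theorem eval_of_product {D : Type*} [DivisionRing D]
    (L R P : Polynomial D) (hP : P = L * R) (d : D) (h : D)
    (hh : h = R.eval d) (hne : h ≠ 0) :
    P.eval d = L.eval (h * d * h⁻¹) * R.eval d ∧
    (P.eval d = 0 → L.eval (h * d * h⁻¹) = 0) := by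
  have key : P.eval d = L.eval (h * d * h⁻¹) * R.eval d := by
    rw [hP]
    refine eval_mul_of_semiconjBy L R ?_
    rw [← hh, SemiconjBy, inv_mul_cancel_right₀ hne]
  refine ⟨key, fun h0 => ?_⟩
  rw [key, ← hh] at h0
  exact (mul_eq_zero.mp h0).resolve_right hne
end

section
/- Let D be a division ring, let a ∈ D and let d ∈ D be an element that does not commute with a. Set q := dad⁻¹ and b := (q − a)·q·(q − a)⁻¹. Then q ≠ a, q ∈ [a], and both a and q are roots of the quadratic polynomial P(x) := (x − b)(x − a) ∈ D[x]; consequently P(x) has infinitely many roots in the conjugacy class [a]. -/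
open Polynomial

theorem finite_ker_aeval_prod_X_sub_C {K V : Type*} [Field K] [AddCommGroup V] [Module K V]
    (T : Module.End K V) (h : ∀ k : K, {x : V | T x = k • x}.Finite) (s : Finset K) :
    {x : V | aeval T (∏ k ∈ s, (X - C k)) x = 0}.Finite := by
  classical
  induction s using Finset.induction_on with
  | empty => simp
  | insert k s hk ih =>
    have hset : {x : V | aeval T (∏ k ∈ insert k s, (X - C k)) x = 0} =
        (fun x => T x - k • x) ⁻¹' {x : V | aeval T (∏ k ∈ s, (X - C k)) x = 0} := by
      ext x
      rw [Finset.prod_insert hk, mul_comm]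
      simp [Module.End.mul_apply]
    rw [hset]
    refine ih.preimage' fun y _ => ?_
    by_cases hy : ∃ z, T z - k • z = y
    · obtain ⟨z, rfl⟩ := hy
      refine ((h k).image (· + z)).subset fun x hx => ⟨x - z, ?_, sub_add_cancel x z⟩
      have hx' : T x - k • x = T z - k • z := hx
      change T (x - z) = k • (x - z)
      rw [map_sub, smul_sub, sub_eq_sub_iff_sub_eq_sub, hx']
    · exact Set.finite_empty.subset fun x hx => hy ⟨x, hx⟩

theorem FiniteField.prod_X_sub_C_eq (K : Type*) [Field K] [Fintype K] :
    ∏ k : K, (X - C k) = (X ^ Fintype.card K - X : K[X]) := by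
  have hq := Fintype.one_lt_card (α := K)
  have hdeg := FiniteField.X_pow_card_sub_X_natDegree_eq K hq
  have hroots := FiniteField.roots_X_pow_card_sub_X K
  have hmonic : (X ^ Fintype.card K - X : K[X]).Monic :=
    monic_X_pow_sub (by rw [degree_X]; exact_mod_cast hq)
  have := prod_multiset_X_sub_C_of_monic_of_roots_card_eq hmonic
    (by rw [hroots, hdeg]; rfl)
  rwa [hroots] at this

/-- A division ring is finite if the centralizer of one of its elements is contained in the image
of a finite field that also contains the element. -/
theorem finite_of_finite_field_of_commute {K D : Type*} [Field K] [Finite K] [DivisionRing D]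
    (φ : K →+* D) (a : K) (hφ : ∀ c : D, Commute (φ a) c → c ∈ Set.range φ) : Finite D := by
  cases nonempty_fintype K
  let _ : Module K D := Module.compHom D φ
  let T : Module.End K D :=
    { toFun := fun x => x * φ a
      map_add' := fun x y => add_mul x y _
      map_smul' := fun k x => mul_assoc (φ k) x (φ a) }
  have hT (x : D) : T x = x * φ a := rfl
  have hTpow (n : ℕ) (x : D) : (T ^ n) x = x * φ a ^ n := by
    induction n with
    | zero => simp
    | succ n ih => rw [pow_succ', Module.End.mul_apply, ih, hT, mul_assoc, pow_succ]
  have hker (k : K) : {x : D | T x = k • x}.Finite := by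
    by_cases hy : ∃ y : D, y ≠ 0 ∧ T y = k • y
    · obtain ⟨y, hy0, hy⟩ := hy
      refine ((Set.finite_range φ).image (y * ·)).subset fun x hx => ?_
      refine ⟨y⁻¹ * x, hφ _ ?_, mul_inv_cancel_left₀ hy0 x⟩
      have hx' : x * φ a = φ k * x := hx
      have hy' : y * φ a = φ k * y := hy
      have hinv : φ a * y⁻¹ = y⁻¹ * φ k := by
        rw [← mul_right_inj' hy0, ← mul_left_inj' hy0]
        simpa [mul_assoc, hy0] using hy'
      rw [Commute, SemiconjBy, ← mul_assoc, hinv, mul_assoc, mul_assoc, hx']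
    · push Not at hy
      refine (Set.finite_singleton (0 : D)).subset fun x hx => ?_
      by_contra hx0
      exact hy x hx0 hx
  have hfin := finite_ker_aeval_prod_X_sub_C T hker Finset.univ
  rw [FiniteField.prod_X_sub_C_eq] at hfin
  refine Set.finite_univ_iff.mp (hfin.subset fun x _ => ?_)
  rw [Set.mem_ofPred_eq, map_sub, map_pow, aeval_X, LinearMap.sub_apply, hTpow, hT, ← map_pow,
    FiniteField.pow_card, sub_self]

/-- In a division ring, a noncentral element has infinite centralizer. -/
theorem infinite_setOf_commute_s12 {D : Type*} [DivisionRing D] {a d : D} (hd : d * a ≠ a * d) :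
    {c : D | Commute a c}.Infinite := by
  intro hfin
  let R := Subring.centralizer ({a} : Set D)
  have hmem (c : D) : c ∈ R ↔ Commute a c := by
    simp [R, Subring.mem_centralizer_iff, Commute, SemiconjBy]
  have : Finite R := (hfin.subset fun c hc => (hmem c).mp hc).to_subtype
  let _ : Field R := (Finite.isDomain_to_isField R).toField
  have : Finite D := finite_of_finite_field_of_commute R.subtype
    ⟨a, (hmem a).mpr (Commute.refl a)⟩ fun c hc => ⟨⟨c, (hmem c).mpr hc⟩, rfl⟩
  exact hd ((Finite.isDomain_to_isField D).mul_comm d a)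

theorem eval_X_sub_C_mul_X_sub_C {R : Type*} [Ring R] (a b r : R) :
    ((X - C b) * (X - C a)).eval r = (r - a) * r - b * (r - a) := by
  have : (X - C b) * (X - C a) = X * X - C a * X - C b * (X - C a) := by
    rw [sub_mul, mul_sub, X_mul_C]
  rw [this]
  simp only [eval_sub, eval_mul_X, eval_C_mul, eval_X, eval_C]
  rw [sub_mul]

theorem eval_conj_eq_zero_iff {D : Type*} [DivisionRing D] (a b : D) {u : D} (hu : u ≠ 0) :
    ((X - C b) * (X - C a)).eval (u * a * u⁻¹) = 0 ↔
      u * a * a - a * u * a - b * (u * a - a * u) = 0 := by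
  rw [eval_X_sub_C_mul_X_sub_C, ← mul_left_inj' hu, zero_mul]
  have h : u * a * u⁻¹ * u = u * a := inv_mul_cancel_right₀ hu _
  have h' : (u * a * u⁻¹ - a) * u = u * a - a * u := by rw [sub_mul, h]
  have h'' : (u * a * u⁻¹ - a) * (u * a * u⁻¹) * u = u * a * a - a * u * a := by
    rw [mul_assoc, h, ← mul_assoc, h', sub_mul]
  rw [sub_mul, h'', mul_assoc b, h']

/-- Distinct translates of `d` by elements commuting with `a` conjugate `a` differently. -/
theorem conj_add_injOn {D : Type*} [DivisionRing D] {a d : D} (hd : d * a ≠ a * d) :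
    Set.InjOn (fun c => (d + c) * a * (d + c)⁻¹) {c : D | Commute a c} := by
  have hne (c : D) (hc : Commute a c) : d + c ≠ 0 := fun h => by
    rw [eq_neg_of_add_eq_zero_left h] at hd
    exact hd hc.neg_right.eq.symm
  intro c hc c' hc' h
  by_contra hcc
  have hcc' : c - c' ≠ 0 := sub_ne_zero.mpr hcc
  have h1 : (d + c) * a * (d + c)⁻¹ = (d + c') * a * (d + c')⁻¹ := h
  set r := (d + c) * a * (d + c)⁻¹
  have e1 : r * (d + c) = (d + c) * a := inv_mul_cancel_right₀ (hne c hc) _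
  have e2 : r * (d + c') = (d + c') * a := by
    rw [h1]; exact inv_mul_cancel_right₀ (hne c' hc') _
  have e3 : r * (c - c') = a * (c - c') := by
    have hs : c - c' = (d + c) - (d + c') := by abel
    rw [(Commute.sub_right hc hc').eq, hs, mul_sub, e1, e2, sub_mul]
  rw [mul_right_cancel₀ hcc' e3, mul_add, add_mul, (show a * c = c * a from hc)] at e1
  exact hd (add_right_cancel e1).symm

/-- **Lemma (a quadratic with two roots in a class).**
Let `D` be a division ring, `a ∈ D`, and `d ∈ D` an element not commuting with `a`.
With `q := d a d⁻¹` and `b := (q − a)·q·(q − a)⁻¹`, we have `q ≠ a`, `q ∈ [a]`, both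
`a` and `q` are roots of `P(x) := (x − b)(x − a)`, and hence `P` has infinitely many
roots in `[a]`. -/
theorem quadratic_two_roots {D : Type*} [DivisionRing D]
    (a d : D) (hd : d * a ≠ a * d)
    (q b : D) (hq : q = d * a * d⁻¹) (hb : b = (q - a) * q * (q - a)⁻¹) :
    q ≠ a ∧ q ∈ conjClass a ∧
    ((X - C b) * (X - C a)).eval a = 0 ∧
    ((X - C b) * (X - C a)).eval q = 0 ∧
    {r : D | r ∈ conjClass a ∧ ((X - C b) * (X - C a)).eval r = 0}.Infinite := by
  have hd0 : d ≠ 0 := by rintro rfl; simp at hd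
  have hqd : q * d = d * a := by rw [hq]; exact inv_mul_cancel_right₀ hd0 _
  have hqa : q ≠ a := by rintro rfl; exact hd hqd.symm
  have hbq : b * (q - a) = (q - a) * q := by
    rw [hb]; exact inv_mul_cancel_right₀ (sub_ne_zero.mpr hqa) _
  have hroot : ((X - C b) * (X - C a)).eval q = 0 := by
    rw [eval_X_sub_C_mul_X_sub_C, hbq, sub_self]
  refine ⟨hqa, ⟨d, hd0, hq⟩, eval_mul_X_sub_C a, hroot, ?_⟩
  refine ((infinite_setOf_commute_s12 hd).image (conj_add_injOn hd)).mono ?_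
  rintro _ ⟨c, hc, rfl⟩
  have hc' : a * c = c * a := hc
  have hdc : d + c ≠ 0 := fun h => by
    rw [eq_neg_of_add_eq_zero_left h] at hd
    exact hd (Commute.neg_right hc).eq.symm
  refine ⟨⟨d + c, hdc, rfl⟩, (eval_conj_eq_zero_iff a b hdc).mpr ?_⟩
  rw [hq] at hroot
  have hcomm : (d + c) * a - a * (d + c) = d * a - a * d := by
    rw [add_mul, mul_add, hc']; abel
  rw [← sub_mul, hcomm, sub_mul]
  exact (eval_conj_eq_zero_iff a b hd0).mp hroot
end

section
/- Let D be a division ring, let a ∈ D and let t ∈ D be an element that does not commute with a. Then (tat⁻¹ − a)·tat⁻¹·(tat⁻¹ − a)⁻¹ = (ta − at)·a·(ta − at)⁻¹; moreover, for any z in the centralizer Z(a), the element t + z does not commute with a and ((t+z)a(t+z)⁻¹ − a)·(t+z)a(t+z)⁻¹·((t+z)a(t+z)⁻¹ − a)⁻¹ = (ta − at)·a·(ta − at)⁻¹. -/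
theorem conj_sub_mul_conj_mul_inv {D : Type*} [DivisionRing D] (a : D) {t : D} (ht : t ≠ 0) :
    (t * a * t⁻¹ - a) * (t * a * t⁻¹) * (t * a * t⁻¹ - a)⁻¹
      = (t * a - a * t) * a * (t * a - a * t)⁻¹ := by
  have h : t * a * t⁻¹ - a = (t * a - a * t) * t⁻¹ := by
    rw [sub_mul, mul_inv_cancel_right₀ ht]
  rw [h, mul_inv_rev, inv_inv]
  simp only [mul_assoc, inv_mul_cancel_left₀ ht]

theorem ne_zero_of_mul_ne_mul {D : Type*} [DivisionRing D] {a t : D} (ht : t * a ≠ a * t) :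
    t ≠ 0 := by
  rintro rfl
  simp at ht

/-- **Lemma (conjugation identity).**
Let `D` be a division ring, `a ∈ D`, and `t ∈ D` not commuting with `a`.  Then
`(t a t⁻¹ − a)·(t a t⁻¹)·(t a t⁻¹ − a)⁻¹ = (t a − a t)·a·(t a − a t)⁻¹`; moreover for
any `z` in the centralizer `Z(a)`, the element `t + z` does not commute with `a` and
`((t+z) a (t+z)⁻¹ − a)·((t+z) a (t+z)⁻¹)·((t+z) a (t+z)⁻¹ − a)⁻¹
  = (t a − a t)·a·(t a − a t)⁻¹`. -/
theorem conjugation_identity {D : Type*} [DivisionRing D]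
    (a t : D) (ht : t * a ≠ a * t) :
    (t * a * t⁻¹ - a) * (t * a * t⁻¹) * (t * a * t⁻¹ - a)⁻¹
      = (t * a - a * t) * a * (t * a - a * t)⁻¹ ∧
    ∀ z : D, a * z = z * a →
      (t + z) * a ≠ a * (t + z) ∧
      ((t + z) * a * (t + z)⁻¹ - a) * ((t + z) * a * (t + z)⁻¹)
          * ((t + z) * a * (t + z)⁻¹ - a)⁻¹
        = (t * a - a * t) * a * (t * a - a * t)⁻¹ := by
  refine ⟨conj_sub_mul_conj_mul_inv a (ne_zero_of_mul_ne_mul ht), fun z hz => ?_⟩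
  have hc : (t + z) * a - a * (t + z) = t * a - a * t := by
    rw [add_mul, mul_add, hz, add_sub_add_right_eq_sub]
  have htz : (t + z) * a ≠ a * (t + z) := by
    rwa [← sub_ne_zero, hc, sub_ne_zero]
  exact ⟨htz, by rw [conj_sub_mul_conj_mul_inv a (ne_zero_of_mul_ne_mul htz), hc]⟩
end

section
/- Let D be a division ring, let a ∈ D and let t ∈ D be an element that does not commute with a. If z, z₁ ∈ Z(a) with z ≠ z₁, then (t + z)·a·(t + z)⁻¹ ≠ (t + z₁)·a·(t + z₁)⁻¹. Consequently, the map z ↦ (t + z)a(t + z)⁻¹ from the centralizer Z(a) into the conjugacy class [a] is injective. -/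
/-- Translating an element that does not commute with `a` by one that does gives a nonzero
element. -/
theorem add_ne_zero_of_not_commute {R : Type*} [Ring R] {a t z : R}
    (ht : ¬ Commute t a) (hz : Commute a z) : t + z ≠ 0 := by
  intro h
  rw [eq_neg_of_add_eq_zero_left h] at ht
  exact ht hz.symm.neg_left

/-- If `t` does not commute with `a`, then `z` in the centralizer of `a` is determined by the
conjugate of `a` by `t + z`. -/
theorem eq_of_conj_add_eq {D : Type*} [DivisionRing D] {a t z z₁ : D}
    (ht : ¬ Commute t a) (hz : Commute a z) (hz₁ : Commute a z₁)
    (h : (t + z) * a * (t + z)⁻¹ = (t + z₁) * a * (t + z₁)⁻¹) : z = z₁ := by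
  set c := (t + z) * a * (t + z)⁻¹ with hc
  have hx : (t + z) * a = c * (t + z) := by
    rw [hc, inv_mul_cancel_right₀ (add_ne_zero_of_not_commute ht hz)]
  have hy : (t + z₁) * a = c * (t + z₁) := by
    rw [h, inv_mul_cancel_right₀ (add_ne_zero_of_not_commute ht hz₁)]
  have hsub : a * (z - z₁) = c * (z - z₁) := by
    calc a * (z - z₁) = (t + z) * a - (t + z₁) * a := by
          rw [(hz.sub_right hz₁).eq]; noncomm_ring
      _ = c * (z - z₁) := by rw [hx, hy]; noncomm_ring
  by_contra hne
  have hac : a = c := mul_right_cancel₀ (sub_ne_zero.mpr hne) hsub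
  rw [← hac] at hx
  have hcomm : Commute (t + z) a := hx
  exact ht (by simpa using hcomm.sub_left hz.symm)


/-- **Lemma (injectivity of `z ↦ (t+z) a (t+z)⁻¹` on the centralizer).**
Let `D` be a division ring, `a ∈ D`, and `t ∈ D` not commuting with `a`.  If
`z, z₁ ∈ Z(a)` with `z ≠ z₁`, then `(t+z) a (t+z)⁻¹ ≠ (t+z₁) a (t+z₁)⁻¹`; consequently
the map `z ↦ (t+z) a (t+z)⁻¹` from `Z(a)` into `[a]` is injective. -/
theorem conj_map_injective {D : Type*} [DivisionRing D]
    (a t : D) (ht : t * a ≠ a * t) :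
    (∀ z z₁ : D, a * z = z * a → a * z₁ = z₁ * a → z ≠ z₁ →
      (t + z) * a * (t + z)⁻¹ ≠ (t + z₁) * a * (t + z₁)⁻¹) ∧
    (∀ z : D, a * z = z * a → (t + z) * a * (t + z)⁻¹ ∈ conjClass a) ∧
    Set.InjOn (fun z : D => (t + z) * a * (t + z)⁻¹) {z : D | a * z = z * a} := by
  have injOn : Set.InjOn (fun z : D => (t + z) * a * (t + z)⁻¹) {z : D | a * z = z * a} :=
    fun z hz z₁ hz₁ h =>
      eq_of_conj_add_eq ht hz hz₁ h
  exact ⟨fun z z₁ hz hz₁ hne h => hne (injOn hz hz₁ h),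
    fun z hz => ⟨t + z, add_ne_zero_of_not_commute ht hz, rfl⟩, injOn⟩
end
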